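/- Every multi-player perfect-information game with probabilistic transitions, with countable state space, nonempty finite action sets, and payoff functions u_i : P → ℝ that are bounded and continuous, admits a sum-secure equilibrium. -/

import Mathlib

open MeasureTheory

/-- A multi-player perfect-information game with probabilistic transitions:
a set of players `N`, a state space `S` with initial state `init`, a controlling
player `ctrl s` and a nonempty finite action set `act s` for every state `s`, and
a transition probability measure `q s a` for every state `s` and action `a`.
The supports of the transition measures are mutually disjoint and every state is
reachable from the initial state, so every state is reached from `init` via
exactly one finite history (states correspond bijectively to histories). -/
structure PGame (N S A : Type*) where
  init : S
  ctrl : S → N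
  act : S → Finset A
  act_nonempty : ∀ s, (act s).Nonempty
  q : S → A → PMF S
  unique_pred : ∀ z s a s' a', a ∈ act s → a' ∈ act s' →
    z ∈ (q s a).support → z ∈ (q s' a').support → s = s' ∧ a = a'
  init_not_succ : ∀ s a, a ∈ act s → init ∉ (q s a).support
  reach : ∀ z, Relation.ReflTransGen (fun s t => ∃ a ∈ act s, t ∈ (q s a).support) init z

namespace PGame

variable {N S A : Type*} (G : PGame N S A)

/-- A play: an infinite alternating sequence of states and actions, starting at the
initial state, choosing legal actions and moving to successor states. -/
def IsPlay (p : ℕ → S × A) : Prop :=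
  (p 0).1 = G.init ∧
    ∀ m, (p m).2 ∈ G.act (p m).1 ∧ (p (m + 1)).1 ∈ (G.q (p m).1 (p m).2).support

/-- The set of plays of the game. -/
def Play : Type _ := { p : ℕ → S × A // G.IsPlay p }

/-- The set of plays carries the topology generated by the cylinder sets, i.e. the
topology induced by the product of the discrete topologies. -/
instance : TopologicalSpace G.Play :=
  letI : TopologicalSpace S := ⊥
  letI : TopologicalSpace A := ⊥
  inferInstanceAs (TopologicalSpace { p : ℕ → S × A // G.IsPlay p })

/-- The Borel σ-algebra on plays. -/
instance : MeasurableSpace G.Play := borel G.Play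

/-- A strategy of player `i`: a choice of a legal action in every state controlled
by `i`. -/
def Strat (i : N) : Type _ := { f : S → A // ∀ s, G.ctrl s = i → f s ∈ G.act s }

/-- A strategy profile. -/
def Profile : Type _ := ∀ i : N, G.Strat i

/-- The profile `σ` with player `i`'s strategy replaced by `τi`. -/
noncomputable def comb (i : N) (τi : G.Strat i) (σ : G.Profile) : G.Profile :=
  haveI := Classical.decEq N
  Function.update σ i τi

/-- The action that profile `σ` plays in state `s`. -/
def playFun (σ : G.Profile) (s : S) : A := (σ (G.ctrl s)).1 s

/-- The cylinder set of plays agreeing with the play `p0` on the first `n`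
coordinates. -/
def cylSet (p0 : G.Play) (n : ℕ) : Set G.Play := { p : G.Play | ∀ m < n, p.1 m = p0.1 m }

open Classical in
/-- `μ` is the family of Borel probability measures on plays induced by the strategy
profiles via the Ionescu–Tulcea construction applied to `q`; it is uniquely
characterized by the probabilities it assigns to the cylinder sets: actions are
chosen deterministically according to the profile and states are drawn from the
transition probabilities. -/
def IsInducedMeasure (μ : G.Profile → Measure G.Play) : Prop :=
  (∀ σ, IsProbabilityMeasure (μ σ)) ∧
    ∀ (σ : G.Profile) (p0 : G.Play) (n : ℕ),
      μ σ (G.cylSet p0 n) =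
        ∏ m ∈ Finset.range n,
          ((if (p0.1 m).2 = G.playFun σ (p0.1 m).1 then 1 else 0) *
            (if m + 1 < n then G.q (p0.1 m).1 (p0.1 m).2 ((p0.1 (m + 1)).1) else 1))

/-- Expected payoff of player `i` under the profile `σ`: the integral of `u i`
against the induced measure. -/
noncomputable def epay (μ : G.Profile → Measure G.Play) (u : N → G.Play → ℝ)
    (σ : G.Profile) (i : N) : ℝ :=
  ∫ p, u i p ∂(μ σ)

/-- Nash equilibrium: no player can improve his expected payoff by a unilateral
deviation. -/
def IsNash (μ : G.Profile → Measure G.Play) (u : N → G.Play → ℝ) (σ : G.Profile) : Prop :=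
  ∀ (i : N) (τi : G.Strat i), G.epay μ u (G.comb i τi σ) i ≤ G.epay μ u σ i

/-- Secure equilibrium: a Nash equilibrium such that no player `i` has a deviation
keeping his own expected payoff equal, making all opponents weakly worse off, and
making some opponent strictly worse off. -/
def IsSecure (μ : G.Profile → Measure G.Play) (u : N → G.Play → ℝ) (σ : G.Profile) : Prop :=
  G.IsNash μ u σ ∧
    ¬ ∃ (i : N) (τi : G.Strat i),
        G.epay μ u (G.comb i τi σ) i = G.epay μ u σ i ∧
        (∀ j : N, j ≠ i → G.epay μ u (G.comb i τi σ) j ≤ G.epay μ u σ j) ∧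
        (∃ k : N, k ≠ i ∧ G.epay μ u (G.comb i τi σ) k < G.epay μ u σ k)

/-- Sum-secure equilibrium: a Nash equilibrium such that any deviation of a player
keeping his own expected payoff equal does not decrease the sum of the expected
payoffs of his opponents. -/
def IsSumSecure [Fintype N] [DecidableEq N] (μ : G.Profile → Measure G.Play)
    (u : N → G.Play → ℝ) (σ : G.Profile) : Prop :=
  G.IsNash μ u σ ∧
    ∀ (i : N) (τi : G.Strat i),
      G.epay μ u (G.comb i τi σ) i = G.epay μ u σ i →
      ∑ j ∈ Finset.univ.erase i, G.epay μ u σ j ≤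
        ∑ j ∈ Finset.univ.erase i, G.epay μ u (G.comb i τi σ) j

end PGame

namespace PGame

section Exp

variable {S : Type*}

/-- Expectation of `X` under a discrete distribution. -/
noncomputable def Ex (p : PMF S) (X : S → ℝ) : ℝ := ∑' z, (p z).toReal * X z

/-- Bounded functions. -/
def Bd (X : S → ℝ) : Prop := ∃ C : ℝ, ∀ s, |X s| ≤ C

theorem Bd.of_between {X lo hi : S → ℝ} (hl : Bd lo) (hh : Bd hi) (h1 : lo ≤ X) (h2 : X ≤ hi) :
    Bd X := by
  obtain ⟨C, hC⟩ := hl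
  obtain ⟨D, hD⟩ := hh
  refine ⟨max C D, fun s => abs_le.2 ⟨?_, ?_⟩⟩
  · have := (abs_le.1 (hC s)).1
    have := h1 s
    have := le_max_left C D
    linarith
  · have := (abs_le.1 (hD s)).2
    have := h2 s
    have := le_max_right C D
    linarith

theorem pmf_summable (p : PMF S) : Summable (fun z => (p z).toReal) :=
  ENNReal.summable_toReal p.tsum_coe_ne_top

theorem pmf_tsum (p : PMF S) : ∑' z, (p z).toReal = 1 := by
  rw [← ENNReal.tsum_toReal_eq (fun a => p.apply_ne_top a), p.tsum_coe]; simp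

theorem summable_ex (p : PMF S) {X : S → ℝ} (hX : Bd X) :
    Summable (fun z => (p z).toReal * X z) := by
  obtain ⟨C, hC⟩ := hX
  refine Summable.of_norm_bounded ((pmf_summable p).mul_right C) (fun z => ?_)
  rw [Real.norm_eq_abs, abs_mul, abs_of_nonneg ENNReal.toReal_nonneg]
  exact mul_le_mul_of_nonneg_left (hC z) ENNReal.toReal_nonneg

theorem ex_le_of_le (p : PMF S) {X Y : S → ℝ} (hX : Bd X) (hY : Bd Y)
    (h : ∀ z ∈ p.support, X z ≤ Y z) : Ex p X ≤ Ex p Y := by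
  refine (summable_ex p hX).tsum_le_tsum (fun z => ?_) (summable_ex p hY)
  by_cases hz : z ∈ p.support
  · exact mul_le_mul_of_nonneg_left (h z hz) ENNReal.toReal_nonneg
  · have : p z = 0 := by simpa [PMF.mem_support_iff] using hz
    simp [this]

theorem ex_congr (p : PMF S) {X Y : S → ℝ} 
    (h : ∀ z ∈ p.support, X z = Y z) : Ex p X = Ex p Y := by
  refine tsum_congr (fun z => ?_)
  by_cases hz : z ∈ p.support
  · rw [h z hz]
  · have : p z = 0 := by simpa [PMF.mem_support_iff] using hz
    simp [this]

theorem ex_const (p : PMF S) (c : ℝ) : Ex p (fun _ => c) = c := by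
  unfold Ex
  rw [tsum_mul_right, pmf_tsum, one_mul]

theorem bd_const (c : ℝ) : Bd (fun _ : S => c) := ⟨|c|, fun _ => le_rfl⟩

theorem ex_eq_imp (p : PMF S) {X Y : S → ℝ} (hX : Bd X) (hY : Bd Y)
    (h : ∀ z ∈ p.support, X z ≤ Y z) (he : Ex p X = Ex p Y) :
    ∀ z ∈ p.support, X z = Y z := by
  intro z hz
  by_contra hne
  have hlt : X z < Y z := lt_of_le_of_ne (h z hz) hne
  have hpos : 0 < (p z).toReal := ENNReal.toReal_pos hz (p.apply_ne_top z)
  refine absurd he (ne_of_lt ?_)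
  refine Summable.tsum_lt_tsum (i := z) (fun y => ?_) (mul_lt_mul_of_pos_left hlt hpos)
    (summable_ex p hX) (summable_ex p hY)
  by_cases hy : y ∈ p.support
  · exact mul_le_mul_of_nonneg_left (h y hy) ENNReal.toReal_nonneg
  · have : p y = 0 := by simpa [PMF.mem_support_iff] using hy
    simp [this]

theorem bd_ex (k : S → PMF S) {X : S → ℝ} (hX : Bd X) : Bd (fun s => Ex (k s) X) := by
  obtain ⟨C, hC⟩ := hX
  refine ⟨C, fun s => abs_le.2 ⟨?_, ?_⟩⟩
  · have := ex_le_of_le (k s) (bd_const (-C)) ⟨C, hC⟩ (fun z _ => (abs_le.1 (hC z)).1)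
    rwa [ex_const] at this
  · have := ex_le_of_le (k s) ⟨C, hC⟩ (bd_const C) (fun z _ => (abs_le.1 (hC z)).2)
    rwa [ex_const] at this

theorem ex_pure (s : S) (X : S → ℝ) : Ex (PMF.pure s) X = X s := by
  unfold Ex
  rw [tsum_eq_single s]
  · simp
  · intro b hb
    simp [PMF.pure_apply, hb]

theorem ex_bind (p : PMF S) (k : S → PMF S) {X : S → ℝ} (hX : Bd X) :
    Ex (p.bind k) X = Ex p (fun s => Ex (k s) X) := by
  obtain ⟨C, hC⟩ := hX
  have hsum : Summable (fun x : S × S => (p x.1).toReal * ((k x.1) x.2).toReal) := by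
    have h0 : 0 ≤ (fun x : S × S => (p x.1).toReal * ((k x.1) x.2).toReal) :=
      fun x => mul_nonneg ENNReal.toReal_nonneg ENNReal.toReal_nonneg
    rw [summable_prod_of_nonneg h0]
    refine ⟨fun s => (pmf_summable (k s)).mul_left (p s).toReal, ?_⟩
    refine (pmf_summable p).congr (fun s => ?_)
    have : ∑' z, (p s).toReal * ((k s) z).toReal = (p s).toReal := by
      rw [tsum_mul_left, pmf_tsum, mul_one]
    exact this.symm
  have hsum2 : Summable (Function.uncurry
      (fun s z : S => (p s).toReal * ((k s z).toReal * X z))) := by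
    refine Summable.of_norm_bounded (hsum.mul_right C) (fun x => ?_)
    obtain ⟨s, z⟩ := x
    simp only [Function.uncurry]
    rw [← mul_assoc, Real.norm_eq_abs, abs_mul, abs_of_nonneg (by positivity)]
    exact mul_le_mul_of_nonneg_left (hC z) (by positivity)
  unfold Ex
  simp_rw [← tsum_mul_left]
  rw [← hsum2.tsum_comm]
  refine tsum_congr (fun z => ?_)
  rw [PMF.bind_apply, ENNReal.tsum_toReal_eq, ← tsum_mul_right]
  · refine tsum_congr (fun s => ?_)
    rw [ENNReal.toReal_mul, mul_assoc]
  · intro s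
    exact ENNReal.mul_ne_top (p.apply_ne_top s) ((k s).apply_ne_top z)

/-- Knaster–Tarski in an order interval of real functions. -/
theorem exists_fixed {lo hi : S → ℝ} (T : (S → ℝ) → S → ℝ) (hlh : lo ≤ hi)
    (hT : ∀ x y, lo ≤ x → x ≤ y → y ≤ hi → T x ≤ T y) (hlo : lo ≤ T lo) (hhi : T hi ≤ hi) :
    ∃ v, lo ≤ v ∧ v ≤ hi ∧ T v = v := by
  let Q : Set (S → ℝ) := {x | lo ≤ x ∧ x ≤ hi ∧ x ≤ T x}
  have hloQ : lo ∈ Q := ⟨le_rfl, hlh, hlo⟩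
  let v : S → ℝ := fun s => sSup ((fun x : S → ℝ => x s) '' Q)
  have hbdd : ∀ s, BddAbove ((fun x : S → ℝ => x s) '' Q) := by
    intro s
    refine ⟨hi s, ?_⟩
    rintro _ ⟨x, hx, rfl⟩
    exact hx.2.1 s
  have hub : ∀ x ∈ Q, x ≤ v := fun x hx s => le_csSup (hbdd s) ⟨x, hx, rfl⟩
  have hlub : ∀ y : S → ℝ, (∀ x ∈ Q, x ≤ y) → v ≤ y := by
    intro y hy s
    refine csSup_le ⟨lo s, lo, hloQ, rfl⟩ ?_
    rintro _ ⟨x, hx, rfl⟩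
    exact hy x hx s
  have h1 : lo ≤ v := hub lo hloQ
  have h2 : v ≤ hi := hlub hi (fun x hx => hx.2.1)
  have h3 : v ≤ T v := hlub _ (fun x hx => hx.2.2.trans (hT x v hx.1 (hub x hx) h2))
  have h4 : T v ∈ Q := by
    refine ⟨h1.trans h3, (hT v hi h1 h2 le_rfl).trans hhi, ?_⟩
    exact hT _ _ h1 h3 ((hT v hi h1 h2 le_rfl).trans hhi)
  exact ⟨v, h1, h2, le_antisymm (hub _ h4) h3⟩

/-- Fixed point of the one-step expectation operator. -/
theorem exists_fixed_ex {lo hi : S → ℝ} (k : S → PMF S) (hlh : lo ≤ hi) (hl : Bd lo) (hh : Bd hi)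
    (hlo : ∀ s, lo s ≤ Ex (k s) lo) (hhi : ∀ s, Ex (k s) hi ≤ hi s) :
    ∃ v, lo ≤ v ∧ v ≤ hi ∧ ∀ s, Ex (k s) v = v s := by
  obtain ⟨v, h1, h2, h3⟩ := exists_fixed (fun x s => Ex (k s) x) hlh
    (fun x y hx hxy hy s => ex_le_of_le _ (hl.of_between hh hx (hxy.trans hy))
      (hl.of_between hh (hx.trans hxy) hy) (fun z _ => hxy z)) hlo hhi
  exact ⟨v, h1, h2, fun s => congrFun h3 s⟩

/-- Existence of values of zero-sum games, in local form. -/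
theorem exists_value {A : Type*} {lo hi : S → ℝ} (q : S → A → PMF S) (B : S → Finset A)
    (hB : ∀ s, (B s).Nonempty) (Mx : S → Prop) (hlh : lo ≤ hi) (hl : Bd lo) (hh : Bd hi)
    (hlo : ∀ s, ∀ a ∈ B s, lo s ≤ Ex (q s a) lo) (hhi : ∀ s, ∀ a ∈ B s, Ex (q s a) hi ≤ hi s) :
    ∃ v, lo ≤ v ∧ v ≤ hi ∧ (∀ s, ∃ a ∈ B s, Ex (q s a) v = v s) ∧
      (∀ s, Mx s → ∀ a ∈ B s, Ex (q s a) v ≤ v s) ∧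
      (∀ s, ¬ Mx s → ∀ a ∈ B s, v s ≤ Ex (q s a) v) := by
  classical
  obtain ⟨v, h1, h2, h3⟩ := exists_fixed (lo := lo) (hi := hi)
    (fun x s => if Mx s then (B s).sup' (hB s) (fun a => Ex (q s a) x)
      else (B s).inf' (hB s) (fun a => Ex (q s a) x)) hlh
    (by
      intro x y hx hxy hy s
      have key : ∀ a, Ex (q s a) x ≤ Ex (q s a) y := fun a =>
        ex_le_of_le _ (hl.of_between hh hx (hxy.trans hy))
          (hl.of_between hh (hx.trans hxy) hy) (fun z _ => hxy z)
      dsimp only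
      split_ifs
      · exact Finset.sup'_mono_fun (fun a _ => key a)
      · exact Finset.inf'_mono_fun (fun a _ => key a))
    (by
      intro s
      dsimp only
      split_ifs
      · obtain ⟨a, ha⟩ := hB s
        exact (hlo s a ha).trans (Finset.le_sup' (fun a => Ex (q s a) lo) ha)
      · exact Finset.le_inf' _ _ (fun a ha => hlo s a ha))
    (by
      intro s
      dsimp only
      split_ifs
      · exact Finset.sup'_le _ _ (fun a ha => hhi s a ha)
      · obtain ⟨a, ha⟩ := hB s
        exact (Finset.inf'_le (fun a => Ex (q s a) hi) ha).trans (hhi s a ha))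
  refine ⟨v, h1, h2, fun s => ?_, fun s hs a ha => ?_, fun s hs a ha => ?_⟩
  · have h := congrFun h3 s
    split_ifs at h
    · obtain ⟨a, ha, h'⟩ := Finset.exists_mem_eq_sup' (hB s) (fun a => Ex (q s a) v)
      exact ⟨a, ha, by rw [← h, h']⟩
    · obtain ⟨a, ha, h'⟩ := Finset.exists_mem_eq_inf' (hB s) (fun a => Ex (q s a) v)
      exact ⟨a, ha, by rw [← h, h']⟩
  · have h := congrFun h3 s
    simp only [hs, if_true] at h
    rw [← h]
    exact Finset.le_sup' (fun a => Ex (q s a) v) ha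
  · have h := congrFun h3 s
    simp only [hs, if_false] at h
    rw [← h]
    exact Finset.inf'_le (fun a => Ex (q s a) v) ha

end Exp

set_option linter.style.haveILetI false

section Plays

variable {N S A : Type*} (G : PGame N S A)

theorem play_unique (p p' : G.Play) : ∀ k k', (p.1 k).1 = (p'.1 k').1 →
    k = k' ∧ ∀ m < k, p.1 m = p'.1 m := by
  intro k
  induction k with
  | zero =>
    intro k' h
    cases k' with
    | zero => exact ⟨rfl, fun m hm => absurd hm (Nat.not_lt_zero m)⟩
    | succ k' =>
      exfalso
      have h2 := p'.2.2 k'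
      rw [← h, p.2.1] at h2
      exact G.init_not_succ _ _ h2.1 h2.2
  | succ k ih =>
    intro k' h
    cases k' with
    | zero =>
      exfalso
      have h2 := p.2.2 k
      rw [h, p'.2.1] at h2
      exact G.init_not_succ _ _ h2.1 h2.2
    | succ k' =>
      have h1 := p.2.2 k
      have h2 := p'.2.2 k'
      rw [h] at h1
      obtain ⟨hs, ha⟩ := G.unique_pred _ _ _ _ _ h1.1 h2.1 h1.2 h2.2
      obtain ⟨hk, hm⟩ := ih k' hs
      subst hk
      refine ⟨rfl, fun m hmk => ?_⟩
      rcases Nat.lt_succ_iff_lt_or_eq.1 hmk with h' | h'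
      · exact hm m h'
      · subst h'
        exact Prod.ext hs ha

/-- An arbitrary successor. -/
noncomputable def nx (π : S → A) (s : S) : S := (G.q s (π s)).support_nonempty.choose

theorem nx_mem (π : S → A) (s : S) : G.nx π s ∈ (G.q s (π s)).support :=
  (G.q s (π s)).support_nonempty.choose_spec

/-- Orbit under arbitrary successors. -/
noncomputable def orb (π : S → A) (t : S) : ℕ → S
  | 0 => t
  | n + 1 => G.nx π (orb π t n)

theorem exists_play (π : S → A) (hπ : ∀ s, π s ∈ G.act s) :
    ∃ p : G.Play, ∀ m, (p.1 m).2 = π (p.1 m).1 := by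
  refine ⟨⟨fun m => (G.orb π G.init m, π (G.orb π G.init m)), rfl, fun m => ⟨hπ _, ?_⟩⟩,
    fun m => rfl⟩
  exact G.nx_mem π _

theorem splice (π : S → A) (hπ : ∀ s, π s ∈ G.act s) (p : G.Play) (n : ℕ) (a : A)
    (ha : a ∈ G.act (p.1 n).1) (t : S) (ht : t ∈ (G.q (p.1 n).1 a).support) :
    ∃ p' : G.Play, (∀ m < n, p'.1 m = p.1 m) ∧ p'.1 n = ((p.1 n).1, a) ∧
      p'.1 (n + 1) = (t, π t) := by
  let f : ℕ → S × A := fun m => if m < n then p.1 m else if m = n then ((p.1 n).1, a) else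
    (G.orb π t (m - n - 1), π (G.orb π t (m - n - 1)))
  have f1 : ∀ m < n, f m = p.1 m := fun m hm => by simp [f, hm]
  have f2 : f n = ((p.1 n).1, a) := by simp [f]
  have f3 : ∀ k, f (n + 1 + k) = (G.orb π t k, π (G.orb π t k)) := by
    intro k
    have e1 : ¬ (n + 1 + k < n) := by omega
    have e2 : ¬ (n + 1 + k = n) := by omega
    have e3 : n + 1 + k - n - 1 = k := by omega
    simp only [f, e1, e2, e3, if_false]
  have f4 : ∀ m ≤ n, (f m).1 = (p.1 m).1 := by
    intro m hm
    rcases Nat.lt_or_eq_of_le hm with h | h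
    · rw [f1 m h]
    · rw [h, f2]
  refine ⟨⟨f, ?_, fun m => ?_⟩, f1, f2, f3 0⟩
  · rw [f4 0 (Nat.zero_le n)]
    exact p.2.1
  · rcases lt_trichotomy m n with h | h | h
    · rw [f1 m h, f4 (m + 1) h]
      exact p.2.2 m
    · subst h
      rw [f2, show m + 1 = m + 1 + 0 from rfl, f3 0]
      exact ⟨ha, ht⟩
    · obtain ⟨k, rfl⟩ : ∃ k, m = n + 1 + k := ⟨m - n - 1, by omega⟩
      rw [f3 k, show n + 1 + k + 1 = n + 1 + (k + 1) by omega, f3 (k + 1)]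
      exact ⟨hπ _, G.nx_mem π _⟩

/-- An arbitrary legal action. -/
noncomputable def anyAct (s : S) : A := (G.act_nonempty s).choose

theorem anyAct_mem (s : S) : G.anyAct s ∈ G.act s := (G.act_nonempty s).choose_spec

theorem exists_play_through (z : S) : ∃ (p : G.Play) (n : ℕ), (p.1 n).1 = z := by
  induction G.reach z with
  | refl =>
    obtain ⟨p, _⟩ := G.exists_play G.anyAct G.anyAct_mem
    exact ⟨p, 0, p.2.1⟩
  | tail _ h ih =>
    obtain ⟨p, n, hp⟩ := ih
    obtain ⟨a, ha, ht⟩ := h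
    subst hp
    obtain ⟨p', -, -, h'⟩ := G.splice G.anyAct G.anyAct_mem p n a ha _ ht
    exact ⟨p', n + 1, by rw [h']⟩

/-- Law of the state at stage `n` when everyone plays according to `a`. -/
noncomputable def law (a : S → A) : ℕ → PMF S
  | 0 => PMF.pure G.init
  | n + 1 => (law a n).bind (fun s => G.q s (a s))

theorem law_play (a : S → A) (ha : ∀ s, a s ∈ G.act s) : ∀ (n : ℕ) (z : S), G.law a n z ≠ 0 →
    ∃ p : G.Play, (p.1 n).1 = z ∧ (∀ m ≤ n, (p.1 m).2 = a (p.1 m).1) ∧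
      ∏ m ∈ Finset.range n, G.q (p.1 m).1 (p.1 m).2 ((p.1 (m + 1)).1) = G.law a n z := by
  intro n
  induction n with
  | zero =>
    intro z hz
    obtain ⟨p, hp⟩ := G.exists_play a ha
    have : z = G.init := by
      by_contra hne
      exact hz (by simp [law, PMF.pure_apply, hne])
    subst this
    exact ⟨p, p.2.1, fun m _ => hp m, by simp [law]⟩
  | succ n ih =>
    intro z hz
    simp only [law, PMF.bind_apply] at hz
    obtain ⟨s, hs⟩ : ∃ s, G.law a n s * G.q s (a s) z ≠ 0 := by
      by_contra hcon
      push Not at hcon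
      exact hz (by simp [hcon])
    have hs1 := left_ne_zero_of_mul hs
    have hs2 := right_ne_zero_of_mul hs
    obtain ⟨p, hpn, hpa, hpp⟩ := ih s hs1
    subst hpn
    obtain ⟨p', h1, h2, h3⟩ := G.splice a ha p n _ (ha _) z hs2
    have h2' : p'.1 n = p.1 n := by
      rw [h2]
      exact Prod.ext rfl (hpa n le_rfl).symm
    have h4 : ∀ m ≤ n, p'.1 m = p.1 m := by
      intro m hm
      rcases Nat.lt_or_eq_of_le hm with h | h
      · exact h1 m h
      · rw [h, h2']
    refine ⟨p', by rw [h3], fun m hm => ?_, ?_⟩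
    · rcases Nat.lt_or_eq_of_le hm with h | h
      · rw [h4 m (Nat.lt_succ_iff.1 h)]
        exact hpa m (Nat.lt_succ_iff.1 h)
      · rw [h, h3]
    · rw [Finset.prod_range_succ, h3, h2]
      simp only [law, PMF.bind_apply]
      rw [tsum_eq_single (p.1 n).1, ← hpp]
      · congr 1
        refine Finset.prod_congr rfl (fun m hm => ?_)
        have := Finset.mem_range.1 hm
        rw [h4 m this.le, h4 (m + 1) this]
      · intro s' hs'
        by_contra hne
        exact hs' (G.unique_pred z _ _ _ _ (ha _) (ha _) (right_ne_zero_of_mul hne) hs2).1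

instance : BorelSpace G.Play := ⟨rfl⟩

theorem continuous_state (X : S → ℝ) (n : ℕ) : Continuous (fun p : G.Play => X (p.1 n).1) := by
  letI : TopologicalSpace S := ⊥
  letI : TopologicalSpace A := ⊥
  haveI : DiscreteTopology S := ⟨rfl⟩
  have h1 : Continuous (fun p : { p : ℕ → S × A // G.IsPlay p } => (p.1 n).1) :=
    continuous_fst.comp ((continuous_apply n).comp continuous_subtype_val)
  exact (continuous_of_discreteTopology (f := X)).comp h1

theorem measurableSet_state (n : ℕ) (z : S) : MeasurableSet {p : G.Play | (p.1 n).1 = z} := by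
  classical
  have h := (G.continuous_state (fun s => if s = z then (1 : ℝ) else 0) n).measurable
  have h2 := h (measurableSet_singleton (1 : ℝ))
  convert h2 using 1
  ext p
  by_cases hp : (p.1 n).1 = z <;> simp [hp]

theorem exists_cyl {f : G.Play → ℝ} (hf : Continuous f) (p : G.Play) {ε : ℝ} (hε : 0 < ε) :
    ∃ n, ∀ p' : G.Play, (∀ m < n, p'.1 m = p.1 m) → |f p' - f p| < ε := by
  letI : TopologicalSpace S := ⊥
  letI : TopologicalSpace A := ⊥
  have ho : IsOpen (f ⁻¹' Metric.ball (f p) ε) := Metric.isOpen_ball.preimage hf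
  obtain ⟨U, hU, hUf⟩ := isOpen_induced_iff.1 ho
  have hpU : p.1 ∈ U := by
    have : p ∈ f ⁻¹' Metric.ball (f p) ε := Metric.mem_ball_self hε
    rw [← hUf] at this
    exact this
  obtain ⟨I, w, hw, hI⟩ := isOpen_pi_iff.1 hU p.1 hpU
  refine ⟨I.sup id + 1, fun p' hp' => ?_⟩
  have h1 : p'.1 ∈ U := by
    apply hI
    intro m hm
    have hmI : m ≤ I.sup id := Finset.le_sup (f := id) hm
    rw [hp' m (Nat.lt_succ_of_le hmI)]
    exact (hw m hm).2
  have h2 : p' ∈ f ⁻¹' Metric.ball (f p) ε := by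
    rw [← hUf]
    exact h1
  simpa [Real.dist_eq] using h2

/-- Values of `f` on plays through `s`. -/
def vals (f : G.Play → ℝ) (s : S) : Set ℝ := {x | ∃ (p : G.Play) (n : ℕ), (p.1 n).1 = s ∧ f p = x}

/-- Largest possible payoff from `s` on. -/
noncomputable def hiV (f : G.Play → ℝ) (s : S) : ℝ := sSup (G.vals f s)

/-- Smallest possible payoff from `s` on. -/
noncomputable def loV (f : G.Play → ℝ) (s : S) : ℝ := sInf (G.vals f s)

variable {G} {f : G.Play → ℝ} {C : ℝ}

theorem vals_nonempty (s : S) : (G.vals f s).Nonempty := by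
  obtain ⟨p, n, h⟩ := G.exists_play_through s
  exact ⟨f p, p, n, h, rfl⟩

theorem vals_above (hC : ∀ p, |f p| ≤ C) (s : S) : BddAbove (G.vals f s) :=
  ⟨C, by rintro _ ⟨p, n, _, rfl⟩; exact (abs_le.1 (hC p)).2⟩

theorem vals_below (hC : ∀ p, |f p| ≤ C) (s : S) : BddBelow (G.vals f s) :=
  ⟨-C, by rintro _ ⟨p, n, _, rfl⟩; exact (abs_le.1 (hC p)).1⟩

theorem lo_le_hi (hC : ∀ p, |f p| ≤ C) : G.loV f ≤ G.hiV f := fun s =>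
  csInf_le_csSup (vals_nonempty s) (vals_below hC s) (vals_above hC s)

theorem bd_hi (hC : ∀ p, |f p| ≤ C) : Bd (G.hiV f) := by
  refine ⟨C, fun s => abs_le.2 ⟨?_, ?_⟩⟩
  · obtain ⟨x, p, n, h, hx⟩ := vals_nonempty (f := f) s
    exact (abs_le.1 (hC p)).1.trans (le_csSup (vals_above hC s) ⟨p, n, h, rfl⟩)
  · refine csSup_le (vals_nonempty s) ?_
    rintro _ ⟨p, n, _, rfl⟩
    exact (abs_le.1 (hC p)).2

theorem bd_lo (hC : ∀ p, |f p| ≤ C) : Bd (G.loV f) := by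
  refine ⟨C, fun s => abs_le.2 ⟨?_, ?_⟩⟩
  · refine le_csInf (vals_nonempty s) ?_
    rintro _ ⟨p, n, _, rfl⟩
    exact (abs_le.1 (hC p)).1
  · obtain ⟨x, p, n, h, hx⟩ := vals_nonempty (f := f) s
    exact (csInf_le (vals_below hC s) ⟨p, n, h, rfl⟩).trans (abs_le.1 (hC p)).2

theorem vals_sub {s : S} {a : A} (ha : a ∈ G.act s) {z : S} (hz : z ∈ (G.q s a).support) :
    G.vals f z ⊆ G.vals f s := by
  rintro _ ⟨p, n, hn, rfl⟩
  cases n with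
  | zero =>
    exfalso
    rw [p.2.1] at hn
    subst hn
    exact G.init_not_succ _ _ ha hz
  | succ n =>
    have h := p.2.2 n
    rw [hn] at h
    exact ⟨p, n, (G.unique_pred z _ _ _ _ h.1 ha h.2 hz).1, rfl⟩

theorem ex_hi_le (hC : ∀ p, |f p| ≤ C) (s : S) (a : A) (ha : a ∈ G.act s) :
    Ex (G.q s a) (G.hiV f) ≤ G.hiV f s := by
  have := ex_le_of_le (G.q s a) (bd_hi hC) (bd_const (G.hiV f s))
    (fun z hz => csSup_le_csSup (vals_above hC s) (vals_nonempty z) (vals_sub ha hz))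
  rwa [ex_const] at this

theorem lo_le_ex (hC : ∀ p, |f p| ≤ C) (s : S) (a : A) (ha : a ∈ G.act s) :
    G.loV f s ≤ Ex (G.q s a) (G.loV f) := by
  have := ex_le_of_le (G.q s a) (bd_const (G.loV f s)) (bd_lo hC) 
    (fun z hz => csInf_le_csInf (vals_below hC s) (vals_nonempty z) (vals_sub ha hz))
  rwa [ex_const] at this

theorem tendsto_state (hf : Continuous f) (hC : ∀ p, |f p| ≤ C) {X : S → ℝ} (h1 : G.loV f ≤ X)
    (h2 : X ≤ G.hiV f) (p : G.Play) :
    Filter.Tendsto (fun n => X (p.1 n).1) Filter.atTop (nhds (f p)) := by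
  rw [Metric.tendsto_atTop]
  intro ε hε
  obtain ⟨n, hn⟩ := G.exists_cyl hf p (half_pos hε)
  refine ⟨n, fun k hk => ?_⟩
  have key : ∀ x ∈ G.vals f (p.1 k).1, |x - f p| < ε / 2 := by
    rintro _ ⟨p', k', h, rfl⟩
    obtain ⟨hkk, hm⟩ := G.play_unique p p' k k' h.symm
    exact hn p' (fun m hmn => (hm m (by omega)).symm)
  have hlo : f p - ε / 2 ≤ G.loV f (p.1 k).1 :=
    le_csInf (vals_nonempty _) (fun x hx => by linarith [(abs_lt.1 (key x hx)).1])
  have hhi : G.hiV f (p.1 k).1 ≤ f p + ε / 2 :=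
    csSup_le (vals_nonempty _) (fun x hx => by linarith [(abs_lt.1 (key x hx)).2])
  have := h1 (p.1 k).1
  have := h2 (p.1 k).1
  rw [Real.dist_eq, abs_lt]
  constructor <;> linarith

variable {μ : G.Profile → Measure G.Play}

/-- Profiles choose legal actions. -/
theorem playFun_mem (σ : G.Profile) (s : S) : G.playFun σ s ∈ G.act s := (σ (G.ctrl s)).2 s rfl

theorem law_le (hμ : G.IsInducedMeasure μ) (σ : G.Profile) (n : ℕ) (z : S) :
    G.law (G.playFun σ) n z ≤ μ σ {p : G.Play | (p.1 n).1 = z} := by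
  by_cases hz : G.law (G.playFun σ) n z = 0
  · rw [hz]; exact zero_le
  obtain ⟨p, hp, hpa, hpp⟩ := G.law_play (G.playFun σ) (playFun_mem σ) n z hz
  have h := hμ.2 σ p (n + 1)
  have hsub : G.cylSet p (n + 1) ⊆ {p : G.Play | (p.1 n).1 = z} := by
    intro p' hp'
    have : p'.1 n = p.1 n := hp' n (Nat.lt_succ_self n)
    change (p'.1 n).1 = z
    rw [this, hp]
  refine le_trans (le_of_eq ?_) (measure_mono hsub)
  rw [h, Finset.prod_range_succ, ← hpp]
  simp only [hpa n le_rfl, if_true, lt_irrefl, if_false, mul_one]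
  refine Finset.prod_congr rfl (fun m hm => ?_)
  have hm' := Finset.mem_range.1 hm
  rw [if_pos (hpa m hm'.le), if_pos (by omega), one_mul]

theorem integral_state [Countable S] (hμ : G.IsInducedMeasure μ) (σ : G.Profile) (n : ℕ)
    {X : S → ℝ} (hX : Bd X) :
    ∫ p, X (p.1 n).1 ∂(μ σ) = Ex (G.law (G.playFun σ) n) X := by
  letI : MeasurableSpace S := ⊤
  haveI := hμ.1 σ
  have hmeas : Measurable (fun p : G.Play => (p.1 n).1) := by
    refine measurable_to_countable' (fun z => G.measurableSet_state n z)
  have hprob : IsProbabilityMeasure ((μ σ).map (fun p : G.Play => (p.1 n).1)) :=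
    Measure.isProbabilityMeasure_map hmeas.aemeasurable
  have hle : (G.law (G.playFun σ) n).toMeasure ≤ (μ σ).map (fun p : G.Play => (p.1 n).1) := by
    refine Measure.le_iff.2 (fun s hs => ?_)
    rw [← Measure.tsum_indicator_apply_singleton _ s hs,
      ← Measure.tsum_indicator_apply_singleton ((μ σ).map _) s hs]
    refine ENNReal.tsum_le_tsum (fun z => Set.indicator_le_indicator ?_)
    rw [PMF.toMeasure_apply_singleton _ _ (MeasurableSet.singleton z),
      Measure.map_apply hmeas (MeasurableSet.singleton z)]
    exact law_le hμ σ n z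
  have heq := Measure.eq_of_le_of_measure_univ_eq hle (by simp)
  have hXm : Measurable X := measurable_from_top
  rw [← integral_map (f := X) hmeas.aemeasurable hXm.aestronglyMeasurable, ← heq,
    PMF.integral_eq_tsum]
  · simp only [smul_eq_mul]
    rfl
  · obtain ⟨C, hC⟩ := hX
    exact Integrable.of_bound hXm.aestronglyMeasurable C (Filter.Eventually.of_forall hC)

theorem tendsto_ex [Countable S] (hμ : G.IsInducedMeasure μ) (σ : G.Profile)
    (hf : Continuous f) (hC : ∀ p, |f p| ≤ C) {X : S → ℝ} (h1 : G.loV f ≤ X)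
    (h2 : X ≤ G.hiV f) :
    Filter.Tendsto (fun n => Ex (G.law (G.playFun σ) n) X) Filter.atTop
      (nhds (∫ p, f p ∂(μ σ))) := by
  haveI := hμ.1 σ
  have hX : Bd X := (bd_lo hC).of_between (bd_hi hC) h1 h2
  simp_rw [← integral_state hμ σ _ hX]
  obtain ⟨D, hD⟩ := hX
  refine tendsto_integral_of_dominated_convergence (fun _ => D)
    (fun n => (G.continuous_state X n).measurable.aestronglyMeasurable) (integrable_const _)
    (fun n => Filter.Eventually.of_forall (fun p => hD _))
    (Filter.Eventually.of_forall (fun p => tendsto_state hf hC h1 h2 p))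

theorem ex_law_succ (a : S → A) (n : ℕ) {X : S → ℝ} (hX : Bd X) :
    Ex (G.law a (n + 1)) X = Ex (G.law a n) (fun s => Ex (G.q s (a s)) X) :=
  ex_bind _ _ hX

/-- Supermartingales. -/
theorem super_le [Countable S] (hμ : G.IsInducedMeasure μ) (σ : G.Profile)
    (hf : Continuous f) (hC : ∀ p, |f p| ≤ C) {X : S → ℝ} (h1 : G.loV f ≤ X)
    (h2 : X ≤ G.hiV f)
    (hs : ∀ n s, G.law (G.playFun σ) n s ≠ 0 → Ex (G.q s (G.playFun σ s)) X ≤ X s) :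
    ∫ p, f p ∂(μ σ) ≤ X G.init ∧ (∫ p, f p ∂(μ σ) = X G.init →
      ∀ n s, G.law (G.playFun σ) n s ≠ 0 → Ex (G.q s (G.playFun σ s)) X = X s) := by
  have hX : Bd X := (bd_lo hC).of_between (bd_hi hC) h1 h2
  have hanti : Antitone (fun n => Ex (G.law (G.playFun σ) n) X) := by
    refine antitone_nat_of_succ_le (fun n => ?_)
    rw [ex_law_succ _ _ hX]
    exact ex_le_of_le _ (bd_ex _ hX) hX (fun z hz => hs n z hz)
  have hlim := tendsto_ex hμ σ hf hC h1 h2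
  have h0 : Ex (G.law (G.playFun σ) 0) X = X G.init := ex_pure _ _
  have hge := fun n => hanti.le_of_tendsto hlim n
  refine ⟨h0 ▸ hge 0, fun he n => ?_⟩
  have hc : ∀ n, Ex (G.law (G.playFun σ) n) X = X G.init := fun n =>
    le_antisymm (h0 ▸ hanti (Nat.zero_le n)) (he ▸ hge n)
  refine ex_eq_imp _ (bd_ex _ hX) hX (fun z hz => hs n z hz) ?_
  rw [← ex_law_succ _ _ hX, hc, hc]

/-- Submartingales. -/
theorem le_sub [Countable S] (hμ : G.IsInducedMeasure μ) (σ : G.Profile)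
    (hf : Continuous f) (hC : ∀ p, |f p| ≤ C) {X : S → ℝ} (h1 : G.loV f ≤ X)
    (h2 : X ≤ G.hiV f)
    (hs : ∀ n s, G.law (G.playFun σ) n s ≠ 0 → X s ≤ Ex (G.q s (G.playFun σ s)) X) :
    X G.init ≤ ∫ p, f p ∂(μ σ) := by
  have hX : Bd X := (bd_lo hC).of_between (bd_hi hC) h1 h2
  have hmono : Monotone (fun n => Ex (G.law (G.playFun σ) n) X) := by
    refine monotone_nat_of_le_succ (fun n => ?_)
    rw [ex_law_succ _ _ hX]
    exact ex_le_of_le _ hX (bd_ex _ hX) (fun z hz => hs n z hz)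
  have hlim := tendsto_ex hμ σ hf hC h1 h2
  have h0 : Ex (G.law (G.playFun σ) 0) X = X G.init := ex_pure _ _
  exact h0 ▸ hmono.ge_of_tendsto hlim 0

end Plays

section Equilibrium

variable {N S A : Type*} {G : PGame N S A}

/-- Lexicographic values of the zero-sum game between player `i` and the others. -/
theorem exists_lex_value (i : N) {f g : G.Play → ℝ} {C D : ℝ} (hC : ∀ p, |f p| ≤ C)
    (hD : ∀ p, |g p| ≤ D) :
    ∃ (v w : S → ℝ) (c : S → A), G.loV f ≤ v ∧ v ≤ G.hiV f ∧ G.loV g ≤ w ∧ w ≤ G.hiV g ∧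
      (∀ s, c s ∈ G.act s) ∧ (∀ s, Ex (G.q s (c s)) v = v s) ∧ (∀ s, Ex (G.q s (c s)) w = w s) ∧
      (∀ s, G.ctrl s = i → ∀ a ∈ G.act s, Ex (G.q s a) v ≤ v s) ∧
      (∀ s, G.ctrl s ≠ i → ∀ a ∈ G.act s, v s ≤ Ex (G.q s a) v) ∧
      (∀ s, G.ctrl s = i → ∀ a ∈ G.act s, Ex (G.q s a) v = v s → w s ≤ Ex (G.q s a) w) ∧
      (∀ s, G.ctrl s ≠ i → ∀ a ∈ G.act s, Ex (G.q s a) v = v s → Ex (G.q s a) w ≤ w s) := by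
  classical
  obtain ⟨v, v1, v2, v3, v4, v5⟩ := exists_value G.q G.act G.act_nonempty
    (fun s => G.ctrl s = i) (lo_le_hi hC) (bd_lo hC) (bd_hi hC)
    (fun s a ha => lo_le_ex hC s a ha) (fun s a ha => ex_hi_le hC s a ha)
  let B : S → Finset A := fun s => (G.act s).filter (fun a => Ex (G.q s a) v = v s)
  have hB : ∀ s, (B s).Nonempty := by
    intro s
    obtain ⟨a, ha, h⟩ := v3 s
    exact ⟨a, Finset.mem_filter.2 ⟨ha, h⟩⟩
  obtain ⟨w, w1, w2, w3, w4, w5⟩ := exists_value G.q B hB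
    (fun s => G.ctrl s ≠ i) (lo_le_hi hD) (bd_lo hD) (bd_hi hD)
    (fun s a ha => lo_le_ex hD s a (Finset.mem_filter.1 ha).1)
    (fun s a ha => ex_hi_le hD s a (Finset.mem_filter.1 ha).1)
  choose c hc1 hc2 using w3
  refine ⟨v, w, c, v1, v2, w1, w2, fun s => (Finset.mem_filter.1 (hc1 s)).1,
    fun s => (Finset.mem_filter.1 (hc1 s)).2, hc2, v4, v5, ?_, ?_⟩
  · intro s hs a ha h
    exact w5 s (by simpa using hs) a (Finset.mem_filter.2 ⟨ha, h⟩)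
  · intro s hs a ha h
    exact w4 s hs a (Finset.mem_filter.2 ⟨ha, h⟩)

/-- Continuation payoffs under the main plan `m`. -/
theorem exists_cont (i : N) {f g : G.Play → ℝ} {C D : ℝ} (hC : ∀ p, |f p| ≤ C)
    (hD : ∀ p, |g p| ≤ D) {v w : S → ℝ} {c m : S → A}
    (v1 : G.loV f ≤ v) (v2 : v ≤ G.hiV f) (w1 : G.loV g ≤ w) (w2 : w ≤ G.hiV g)
    (c1 : ∀ s, Ex (G.q s (c s)) v = v s) (c2 : ∀ s, Ex (G.q s (c s)) w = w s)
    (v5 : ∀ s, G.ctrl s ≠ i → ∀ a ∈ G.act s, v s ≤ Ex (G.q s a) v)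
    (w5 : ∀ s, G.ctrl s ≠ i → ∀ a ∈ G.act s, Ex (G.q s a) v = v s → Ex (G.q s a) w ≤ w s)
    (hm : ∀ s, m s ∈ G.act s) (hmc : ∀ s, G.ctrl s = i → m s = c s) :
    ∃ V W : S → ℝ, v ≤ V ∧ V ≤ G.hiV f ∧ G.loV g ≤ W ∧ W ≤ G.hiV g ∧
      (∀ s, Ex (G.q s (m s)) V = V s) ∧ (∀ s, Ex (G.q s (m s)) W = W s) ∧
      (∀ s, v s = V s → W s ≤ w s) := by
  classical
  have hv : Bd v := (bd_lo hC).of_between (bd_hi hC) v1 v2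
  have hw : Bd w := (bd_lo hD).of_between (bd_hi hD) w1 w2
  have hvm : ∀ s, v s ≤ Ex (G.q s (m s)) v := by
    intro s
    by_cases h : G.ctrl s = i
    · rw [hmc s h, c1]
    · exact v5 s h _ (hm s)
  have hwm : ∀ s, Ex (G.q s (m s)) v = v s → Ex (G.q s (m s)) w ≤ w s := by
    intro s he
    by_cases h : G.ctrl s = i
    · rw [hmc s h, c2]
    · exact w5 s h _ (hm s) he
  obtain ⟨V, V1, V2, V3⟩ := exists_fixed_ex (fun s => G.q s (m s)) v2 hv (bd_hi hC) hvm
    (fun s => ex_hi_le hC s _ (hm s))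
  have hV : Bd V := hv.of_between (bd_hi hC) V1 V2
  let M : S → ℝ := fun s => if v s = V s then w s else G.hiV g s
  have hM1 : G.loV g ≤ M := by
    intro s
    simp only [M]
    split_ifs
    · exact w1 s
    · exact lo_le_hi hD s
  have hM2 : M ≤ G.hiV g := by
    intro s
    simp only [M]
    split_ifs
    · exact w2 s
    · exact le_rfl
  have hM : Bd M := (bd_lo hD).of_between (bd_hi hD) hM1 hM2
  obtain ⟨W, W1, W2, W3⟩ := exists_fixed_ex (fun s => G.q s (m s)) hM1 (bd_lo hD) hM
    (fun s => lo_le_ex hD s _ (hm s)) (by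
      intro s
      by_cases h : v s = V s
      · have e1 : Ex (G.q s (m s)) v = v s := by
          refine le_antisymm ?_ (hvm s)
          have := ex_le_of_le (G.q s (m s)) hv hV (fun z _ => V1 z)
          have h3 := V3 s
          rwa [h3, ← h] at this
        have e2 : ∀ z ∈ (G.q s (m s)).support, v z = V z := by
          refine ex_eq_imp _ hv hV (fun z _ => V1 z) ?_
          rw [e1, h]
          exact (V3 s).symm
        have e3 : Ex (G.q s (m s)) M = Ex (G.q s (m s)) w :=
          ex_congr _ (fun z hz => by simp [M, e2 z hz])
        have e4 : M s = w s := by simp [M, h]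
        rw [e3, e4]
        exact hwm s e1
      · have e4 : M s = G.hiV g s := by simp [M, h]
        rw [e4]
        exact (ex_le_of_le _ hM (bd_hi hD) (fun z _ => hM2 z)).trans (ex_hi_le hD s _ (hm s)))
  refine ⟨V, W, V1, V2, W1, W2.trans hM2, V3, W3, fun s h => ?_⟩
  have := W2 s
  simpa [M, h] using this

variable (G)

/-- States reached while the main plan `m` has been followed. -/
inductive MainSt (m : S → A) : S → Prop
  | init : MainSt m G.init
  | step (s t : S) : MainSt m s → t ∈ (G.q s (m s)).support → MainSt m t

/-- States for which the first deviation from `m` was made by player `i`. -/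
inductive DevSt (m : S → A) (i : N) : S → Prop
  | start (s t : S) (a : A) : MainSt G m s → G.ctrl s = i → a ∈ G.act s → a ≠ m s →
      t ∈ (G.q s a).support → DevSt m i t
  | step (s t : S) (a : A) : DevSt m i s → a ∈ G.act s → t ∈ (G.q s a).support → DevSt m i t

variable {G}

theorem not_dev_of_main {m : S → A} (hm : ∀ s, m s ∈ G.act s) {s : S} (h : MainSt G m s) (i : N) :
    ¬ DevSt G m i s := by
  induction h with
  | init =>
    intro hd
    cases hd with
    | start s t a _ _ ha _ ht => exact G.init_not_succ _ _ ha ht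
    | step s t a _ ha ht => exact G.init_not_succ _ _ ha ht
  | step s t _ hst ih =>
    intro hd
    cases hd with
    | start s' t a _ _ ha hne ht =>
      obtain ⟨h1, h2⟩ := G.unique_pred _ _ _ _ _ ha (hm s) ht hst
      subst h1
      exact hne h2
    | step s' t a hd' ha ht =>
      obtain ⟨h1, h2⟩ := G.unique_pred _ _ _ _ _ ha (hm s) ht hst
      subst h1
      exact ih hd'

theorem dev_unique {m : S → A} (hm : ∀ s, m s ∈ G.act s) {i j : N} {s : S}
    (h : DevSt G m i s) (h' : DevSt G m j s) : i = j := by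
  induction h with
  | start s t a hs hi ha hne ht =>
    cases h' with
    | start s' t a' _ hj ha' _ ht' =>
      obtain ⟨h1, h2⟩ := G.unique_pred _ _ _ _ _ ha ha' ht ht'
      subst h1
      exact hi.symm.trans hj
    | step s' t a' hd ha' ht' =>
      obtain ⟨h1, h2⟩ := G.unique_pred _ _ _ _ _ ha ha' ht ht'
      subst h1
      exact absurd hd (not_dev_of_main hm hs j)
  | step s t a hd ha ht ih =>
    cases h' with
    | start s' t a' hs hj ha' _ ht' =>
      obtain ⟨h1, h2⟩ := G.unique_pred _ _ _ _ _ ha ha' ht ht'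
      subst h1
      exact absurd hd (not_dev_of_main hm hs i)
    | step s' t a' hd ha' ht' =>
      obtain ⟨h1, h2⟩ := G.unique_pred _ _ _ _ _ ha ha' ht ht'
      subst h1
      exact ih hd

theorem law_inv {a : S → A} {P : S → Prop} (h0 : P G.init)
    (hstep : ∀ s, P s → ∀ t ∈ (G.q s (a s)).support, P t) :
    ∀ n s, G.law a n s ≠ 0 → P s := by
  intro n
  induction n with
  | zero =>
    intro s hs
    have : s = G.init := by
      by_contra hne
      exact hs (by simp [law, PMF.pure_apply, hne])
    rw [this]
    exact h0
  | succ n ih =>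
    intro z hz
    simp only [law, PMF.bind_apply] at hz
    obtain ⟨s, hs⟩ : ∃ s, G.law a n s * G.q s (a s) z ≠ 0 := by
      by_contra hcon
      push Not at hcon
      exact hz (by simp [hcon])
    exact hstep s (ih s (left_ne_zero_of_mul hs)) z (right_ne_zero_of_mul hs)

theorem exists_lex_equilibrium [Countable S] {f g : N → G.Play → ℝ}
    (hf : ∀ i, Continuous (f i)) (hg : ∀ i, Continuous (g i))
    (hfb : ∀ i, ∃ C : ℝ, ∀ p, |f i p| ≤ C) (hgb : ∀ i, ∃ C : ℝ, ∀ p, |g i p| ≤ C)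
    {μ : G.Profile → Measure G.Play} (hμ : G.IsInducedMeasure μ) :
    ∃ σ : G.Profile, ∀ (i : N) (τi : G.Strat i),
      ∫ p, f i p ∂(μ (G.comb i τi σ)) ≤ ∫ p, f i p ∂(μ σ) ∧
      (∫ p, f i p ∂(μ (G.comb i τi σ)) = ∫ p, f i p ∂(μ σ) →
        ∫ p, g i p ∂(μ σ) ≤ ∫ p, g i p ∂(μ (G.comb i τi σ))) := by
  classical
  choose C hC using hfb
  choose D hD using hgb
  choose v w c v1 v2 w1 w2 hc c1 c2 v4 v5 w4 w5 using
    fun i => exists_lex_value i (hC i) (hD i)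
  let m : S → A := fun s => c (G.ctrl s) s
  have hm : ∀ s, m s ∈ G.act s := fun s => hc _ s
  choose V W V1 V2 W1 W2 V3 W3 VW using fun i => exists_cont (m := m) i (hC i) (hD i) (v1 i) (v2 i)
    (w1 i) (w2 i) (c1 i) (c2 i) (v5 i) (w5 i) hm (fun s hs => by simp only [m, hs])
  let b : S → A := fun s => if h : ∃ i, DevSt G m i s then c h.choose s else m s
  have hb : ∀ s, b s ∈ G.act s := by
    intro s
    simp only [b]
    split_ifs with h
    · exact hc _ s
    · exact hm s
  have bmain : ∀ s, MainSt G m s → b s = m s := by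
    intro s hs
    simp only [b]
    rw [dif_neg]
    rintro ⟨i, hi⟩
    exact not_dev_of_main hm hs i hi
  have bdev : ∀ s i, DevSt G m i s → b s = c i s := by
    intro s i hi
    have h : ∃ i, DevSt G m i s := ⟨i, hi⟩
    simp only [b]
    rw [dif_pos h, dev_unique hm h.choose_spec hi]
  let σ : G.Profile := fun j => ⟨b, fun s _ => hb s⟩
  have hσ : ∀ s, G.playFun σ s = b s := fun s => rfl
  have hmainlaw : ∀ n s, G.law (G.playFun σ) n s ≠ 0 → MainSt G m s := by
    refine law_inv MainSt.init (fun s hs t ht => ?_)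
    rw [hσ, bmain s hs] at ht
    exact MainSt.step s t hs ht
  have hfσ : ∀ i, ∫ p, f i p ∂(μ σ) = V i G.init := by
    intro i
    have key : ∀ n s, G.law (G.playFun σ) n s ≠ 0 → Ex (G.q s (G.playFun σ s)) (V i) = V i s := by
      intro n s hs
      rw [hσ, bmain s (hmainlaw n s hs)]
      exact V3 i s
    exact le_antisymm
      (super_le hμ σ (hf i) (hC i) ((v1 i).trans (V1 i)) (V2 i) (fun n s h => (key n s h).le)).1
      (le_sub hμ σ (hf i) (hC i) ((v1 i).trans (V1 i)) (V2 i) (fun n s h => (key n s h).ge))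
  have hgσ : ∀ i, ∫ p, g i p ∂(μ σ) = W i G.init := by
    intro i
    have key : ∀ n s, G.law (G.playFun σ) n s ≠ 0 → Ex (G.q s (G.playFun σ s)) (W i) = W i s := by
      intro n s hs
      rw [hσ, bmain s (hmainlaw n s hs)]
      exact W3 i s
    exact le_antisymm
      (super_le hμ σ (hg i) (hD i) (W1 i) (W2 i) (fun n s h => (key n s h).le)).1
      (le_sub hμ σ (hg i) (hD i) (W1 i) (W2 i) (fun n s h => (key n s h).ge))
  refine ⟨σ, fun i τi => ?_⟩
  set τ := G.comb i τi σ with hτdef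
  have hτ : ∀ s, G.ctrl s ≠ i → G.playFun τ s = b s := by
    intro s hs
    have h : τ (G.ctrl s) = σ (G.ctrl s) :=
      @Function.update_of_ne N G.Strat (Classical.decEq N) (G.ctrl s) i hs τi σ
    change (τ (G.ctrl s)).1 s = b s
    rw [h]
  have hτa : ∀ s, G.playFun τ s ∈ G.act s := playFun_mem τ
  -- one step from a main state
  have mainstep : ∀ s, MainSt G m s → G.playFun τ s = m s ∨
      (G.ctrl s = i ∧ G.playFun τ s ≠ m s) := by
    intro s hs
    by_cases he : G.playFun τ s = m s
    · exact Or.inl he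
    · refine Or.inr ⟨?_, he⟩
      by_contra hi
      exact he ((hτ s hi).trans (bmain s hs))
  have hlaw : ∀ n s, G.law (G.playFun τ) n s ≠ 0 → MainSt G m s ∨ DevSt G m i s := by
    refine law_inv (Or.inl MainSt.init) (fun s hs t ht => ?_)
    rcases hs with hs | hs
    · rcases mainstep s hs with he | ⟨hi, hne⟩
      · rw [he] at ht
        exact Or.inl (MainSt.step s t hs ht)
      · exact Or.inr (DevSt.start s t _ hs hi (hτa s) hne ht)
    · exact Or.inr (DevSt.step s t _ hs (hτa s) ht)
  let U : S → ℝ := fun s => if DevSt G m i s then v i s else V i s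
  let R : S → ℝ := fun s => if DevSt G m i s then w i s else W i s
  have U1 : G.loV (f i) ≤ U := by
    intro s
    simp only [U]
    split_ifs
    · exact v1 i s
    · exact (v1 i s).trans (V1 i s)
  have U2 : U ≤ G.hiV (f i) := by
    intro s
    simp only [U]
    split_ifs
    · exact v2 i s
    · exact V2 i s
  have R1 : G.loV (g i) ≤ R := by
    intro s
    simp only [R]
    split_ifs
    · exact w1 i s
    · exact W1 i s
  have R2 : R ≤ G.hiV (g i) := by
    intro s
    simp only [R]
    split_ifs
    · exact w2 i s
    · exact W2 i s
  have Umain : ∀ s, MainSt G m s → U s = V i s := fun s hs => by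
    simp only [U, not_dev_of_main hm hs i, if_false]
  have Rmain : ∀ s, MainSt G m s → R s = W i s := fun s hs => by
    simp only [R, not_dev_of_main hm hs i, if_false]
  have Udev : ∀ s, DevSt G m i s → U s = v i s := fun s hs => by simp only [U, hs, if_true]
  have Rdev : ∀ s, DevSt G m i s → R s = w i s := fun s hs => by simp only [R, hs, if_true]
  -- description of one step
  have stepA : ∀ s, MainSt G m s → G.playFun τ s = m s →
      Ex (G.q s (G.playFun τ s)) U = U s ∧ Ex (G.q s (G.playFun τ s)) R = R s := by
    intro s hs he
    rw [he, Umain s hs, Rmain s hs, ← V3 i s, ← W3 i s]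
    exact ⟨ex_congr _ (fun z hz => Umain z (MainSt.step s z hs hz)),
      ex_congr _ (fun z hz => Rmain z (MainSt.step s z hs hz))⟩
  have stepB : ∀ s, (∀ z ∈ (G.q s (G.playFun τ s)).support, DevSt G m i z) →
      Ex (G.q s (G.playFun τ s)) U = Ex (G.q s (G.playFun τ s)) (v i) ∧
      Ex (G.q s (G.playFun τ s)) R = Ex (G.q s (G.playFun τ s)) (w i) := by
    intro s h
    exact ⟨ex_congr _ (fun z hz => Udev z (h z hz)), ex_congr _ (fun z hz => Rdev z (h z hz))⟩
  have stepU : ∀ s, MainSt G m s ∨ DevSt G m i s →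
      Ex (G.q s (G.playFun τ s)) U ≤ U s ∧
      (Ex (G.q s (G.playFun τ s)) U = U s → R s ≤ Ex (G.q s (G.playFun τ s)) R) := by
    rintro s (hs | hs)
    · rcases mainstep s hs with he | ⟨hi, hne⟩
      · exact ⟨(stepA s hs he).1.le, fun _ => (stepA s hs he).2.ge⟩
      · obtain ⟨e1, e2⟩ := stepB s (fun z hz => DevSt.start s z _ hs hi (hτa s) hne hz)
        rw [e1, e2, Umain s hs, Rmain s hs]
        have h1 := v4 i s hi _ (hτa s)
        have h2 := V1 i s
        refine ⟨h1.trans h2, fun he => ?_⟩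
        have h3 : Ex (G.q s (G.playFun τ s)) (v i) = v i s := le_antisymm h1 (he ▸ h2)
        exact (VW i s (h3 ▸ he)).trans (w4 i s hi _ (hτa s) h3)
    · obtain ⟨e1, e2⟩ := stepB s (fun z hz => DevSt.step s z _ hs (hτa s) hz)
      rw [e1, e2, Udev s hs, Rdev s hs]
      by_cases hi : G.ctrl s = i
      · exact ⟨v4 i s hi _ (hτa s), fun he => w4 i s hi _ (hτa s) he⟩
      · rw [hτ s hi, bdev s i hs]
        exact ⟨(c1 i s).le, fun _ => (c2 i s).ge⟩
  have hsup := super_le hμ τ (hf i) (hC i) U1 U2 (fun n s h => (stepU s (hlaw n s h)).1)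
  rw [Umain _ MainSt.init] at hsup
  rw [hfσ i, hgσ i]
  refine ⟨hsup.1, fun he => ?_⟩
  have hmart := hsup.2 he
  have := le_sub hμ τ (hg i) (hD i) R1 R2
    (fun n s h => (stepU s (hlaw n s h)).2 (hmart n s h))
  rwa [Rmain _ MainSt.init] at this

end Equilibrium

end PGame


/-- **Existence of sum-secure equilibrium**: every multi-player perfect-information
game with probabilistic transitions, countable state space, nonempty finite action
sets, and bounded continuous payoff functions admits a sum-secure equilibrium. -/
theorem exists_sum_secure_equilibrium
    {N S A : Type*} [Fintype N] [DecidableEq N] [Countable S]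
    (hN : 2 ≤ Fintype.card N)
    (G : PGame N S A) (u : N → G.Play → ℝ)
    (hu_bdd : ∀ i : N, ∃ C : ℝ, ∀ p : G.Play, |u i p| ≤ C)
    (hu_cont : ∀ i : N, Continuous (u i))
    (μ : G.Profile → MeasureTheory.Measure G.Play)
    (hμ : G.IsInducedMeasure μ) :
    ∃ σ : G.Profile, G.IsSumSecure μ u σ := by
  have bdd_int : ∀ (ν : G.Profile) (j : N), MeasureTheory.Integrable (u j) (μ ν) := by
    intro ν j
    haveI := hμ.1 ν
    obtain ⟨C, hC⟩ := hu_bdd j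
    exact MeasureTheory.Integrable.of_bound (hu_cont j).measurable.aestronglyMeasurable C
      (Filter.Eventually.of_forall hC)
  obtain ⟨σ, hσ⟩ := PGame.exists_lex_equilibrium (f := u)
    (g := fun i p => ∑ j ∈ Finset.univ.erase i, u j p) hu_cont
    (fun i => continuous_finsetSum _ (fun j _ => hu_cont j)) hu_bdd
    (by
      intro i
      choose C hC using hu_bdd
      refine ⟨∑ j ∈ Finset.univ.erase i, C j, fun p => ?_⟩
      exact (Finset.abs_sum_le_sum_abs _ _).trans (Finset.sum_le_sum (fun j _ => hC j p))) hμ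
  refine ⟨σ, fun i τi => (hσ i τi).1, fun i τi he => ?_⟩
  have h := (hσ i τi).2 he
  rw [MeasureTheory.integral_finset_sum _ (fun j _ => bdd_int _ j),
    MeasureTheory.integral_finset_sum _ (fun j _ => bdd_int _ j)] at h
  exact h
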